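/- arXiv:1309.3939 — 2 statements merged into one kernel-verified Lean document; each statement's English description precedes it below -/
import Mathlib

section
/- Let Sym₃ denote the subspace of Matrix (Fin 3) (Fin 3) ℝ consisting of symmetric matrices (Mᵀ = M). The set of linear maps C : Sym₃ →ₗ[ℝ] Sym₃ satisfying C (Q * E * Qᵀ) = Q * (C E) * Qᵀ for every Q ∈ SO(3) and every symmetric E is an ℝ-submodule of Sym₃ →ₗ[ℝ] Sym₃ of finrank exactly 2. -/
open Matrix

/-- The space of symmetric 3×3 real matrices. -/
def Sym3 : Submodule ℝ (Matrix (Fin 3) (Fin 3) ℝ) where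
  carrier := {M | Mᵀ = M}
  add_mem' := by
    intro a b ha hb
    simp only [Set.mem_setOf_eq] at *
    rw [Matrix.transpose_add, ha, hb]
  zero_mem' := Matrix.transpose_zero
  smul_mem' := by
    intro c a ha
    simp only [Set.mem_setOf_eq] at *
    rw [Matrix.transpose_smul, ha]

/-- Helper instance (definitionally the standard one; typeclass search fails to find it
due to a unification issue with nested submodules). -/
noncomputable instance (S : Submodule ℝ (Sym3 →ₗ[ℝ] Sym3)) : AddCommGroup ↥S :=
  @Submodule.addCommGroup ℝ (Sym3 →ₗ[ℝ] Sym3) _ _ _ S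

/-- Equivariance under SO(3). -/
def Equivar (C : Sym3 →ₗ[ℝ] Sym3) : Prop :=
  ∀ Q : Matrix (Fin 3) (Fin 3) ℝ, Qᵀ * Q = 1 → Q.det = 1 →
    ∀ (E : Sym3) (hE : Q * (E : Matrix (Fin 3) (Fin 3) ℝ) * Qᵀ ∈ Sym3),
      ((C ⟨Q * (E : Matrix (Fin 3) (Fin 3) ℝ) * Qᵀ, hE⟩ : Sym3) : Matrix (Fin 3) (Fin 3) ℝ)
        = Q * ((C E : Sym3) : Matrix (Fin 3) (Fin 3) ℝ) * Qᵀ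

/-- A symmetric matrix from its six entries. -/
def mkS (a b c d e f : ℝ) : Sym3 :=
  ⟨!![a, d, e; d, b, f; e, f, c], by
    change (!![a, d, e; d, b, f; e, f, c])ᵀ = !![a, d, e; d, b, f; e, f, c]
    ext i j; fin_cases i <;> fin_cases j <;> rfl⟩

theorem exists_mkS (E : Sym3) : ∃ a b c d e f, E = mkS a b c d e f := by
  obtain ⟨M, hM⟩ := E
  have hM' : Mᵀ = M := hM
  refine ⟨M 0 0, M 1 1, M 2 2, M 0 1, M 0 2, M 1 2, ?_⟩
  apply Subtype.ext
  have h (i j) : M j i = M i j := congrFun (congrFun hM' i) j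
  ext i j
  fin_cases i <;> fin_cases j <;> simp [mkS, h 0 1, h 0 2, h 1 2]

theorem mkS_congr {a b c d e f a' b' c' d' e' f' : ℝ}
    (h : (mkS a b c d e f).1 = (mkS a' b' c' d' e' f').1) :
    a = a' ∧ b = b' ∧ c = c' ∧ d = d' ∧ e = e' ∧ f = f' :=
  ⟨congrFun (congrFun h 0) 0, congrFun (congrFun h 1) 1, congrFun (congrFun h 2) 2,
    congrFun (congrFun h 0) 1, congrFun (congrFun h 0) 2, congrFun (congrFun h 1) 2⟩

/-- The map E ↦ tr(E) I. -/
noncomputable def trMap : Sym3 →ₗ[ℝ] Sym3 where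
  toFun E := E.1.trace • mkS 1 1 1 0 0 0
  map_add' E F := by
    rw [Submodule.coe_add, Matrix.trace_add, add_smul]
  map_smul' c E := by
    rw [Submodule.coe_smul, Matrix.trace_smul, smul_assoc, RingHom.id_apply]

theorem mkS_one : (mkS 1 1 1 0 0 0).1 = (1 : Matrix (Fin 3) (Fin 3) ℝ) := by
  ext i j; fin_cases i <;> fin_cases j <;> simp [mkS]

theorem trMap_coe (E : Sym3) : (trMap E).1 = E.1.trace • (1 : Matrix (Fin 3) (Fin 3) ℝ) := by
  rw [← mkS_one]; rfl

theorem equivar_comb (a b : ℝ) : Equivar (a • LinearMap.id + b • trMap) := by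
  intro Q hQ _ E hE
  have hQ' : Q * Qᵀ = 1 := mul_eq_one_comm.mp hQ
  have ht : (Q * E.1 * Qᵀ).trace = E.1.trace := by
    rw [Matrix.trace_mul_comm, ← Matrix.mul_assoc, hQ, Matrix.one_mul]
  simp only [LinearMap.add_apply, LinearMap.smul_apply, LinearMap.id_apply, Submodule.coe_add,
    Submodule.coe_smul, trMap_coe, ht, Matrix.mul_add, Matrix.add_mul, Matrix.mul_smul,
    Matrix.smul_mul, Matrix.mul_one, hQ']

theorem Equivar.sub {C D : Sym3 →ₗ[ℝ] Sym3} (hC : Equivar C) (hD : Equivar D) :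
    Equivar (C - D) := by
  intro Q hQ hd E hE
  simp only [LinearMap.sub_apply, Submodule.coe_sub, hC Q hQ hd E hE, hD Q hQ hd E hE,
    Matrix.mul_sub, Matrix.sub_mul]

theorem Equivar.conj {C : Sym3 →ₗ[ℝ] Sym3} (hC : Equivar C)
    (Q : Matrix (Fin 3) (Fin 3) ℝ) (hQ : Qᵀ * Q = 1) (hd : Q.det = 1) (E F : Sym3)
    (h : F.1 = Q * E.1 * Qᵀ) : (C F).1 = Q * (C E).1 * Qᵀ := by
  have := hC Q hQ hd E (h ▸ F.2)
  rw [← this]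
  congr 2
  exact Subtype.ext h

theorem ker_of_D1 {C : Sym3 →ₗ[ℝ] Sym3} (hC : Equivar C) (h1 : C (mkS 1 0 0 0 0 0) = 0) :
    C = 0 := by
  have key (Q : Matrix (Fin 3) (Fin 3) ℝ) (hQ : Qᵀ * Q = 1) (hd : Q.det = 1) (F : Sym3)
      (h : F.1 = Q * (mkS 1 0 0 0 0 0).1 * Qᵀ) : C F = 0 := by
    apply Subtype.ext
    rw [hC.conj Q hQ hd _ F h, h1]; simp
  have h2 : C (mkS 0 1 0 0 0 0) = 0 := by
    apply key !![0, -1, 0; 1, 0, 0; 0, 0, 1]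
    · ext i j; fin_cases i <;> fin_cases j <;> simp [Matrix.mul_apply, Fin.sum_univ_three] <;> norm_num
    · simp [Matrix.det_fin_three] <;> norm_num
    · ext i j; fin_cases i <;> fin_cases j <;> simp [mkS, Matrix.mul_apply, Fin.sum_univ_three] <;> norm_num
  have h3 : C (mkS 0 0 1 0 0 0) = 0 := by
    apply key !![0, 0, -1; 0, 1, 0; 1, 0, 0]
    · ext i j; fin_cases i <;> fin_cases j <;> simp [Matrix.mul_apply, Fin.sum_univ_three] <;> norm_num
    · simp [Matrix.det_fin_three] <;> norm_num
    · ext i j; fin_cases i <;> fin_cases j <;> simp [mkS, Matrix.mul_apply, Fin.sum_univ_three] <;> norm_num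
  have h4 : C (mkS (9/25) (16/25) 0 (12/25) 0 0) = 0 := by
    apply key !![3/5, -4/5, 0; 4/5, 3/5, 0; 0, 0, 1]
    · ext i j; fin_cases i <;> fin_cases j <;> simp [Matrix.mul_apply, Fin.sum_univ_three] <;> norm_num
    · simp [Matrix.det_fin_three] <;> norm_num
    · ext i j; fin_cases i <;> fin_cases j <;> simp [mkS, Matrix.mul_apply, Fin.sum_univ_three] <;> norm_num
  have h5 : C (mkS (9/25) 0 (16/25) 0 (12/25) 0) = 0 := by
    apply key !![3/5, 0, -4/5; 0, 1, 0; 4/5, 0, 3/5]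
    · ext i j; fin_cases i <;> fin_cases j <;> simp [Matrix.mul_apply, Fin.sum_univ_three] <;> norm_num
    · simp [Matrix.det_fin_three] <;> norm_num
    · ext i j; fin_cases i <;> fin_cases j <;> simp [mkS, Matrix.mul_apply, Fin.sum_univ_three] <;> norm_num
  have h6 : C (mkS 0 (9/25) (16/25) 0 0 (12/25)) = 0 := by
    apply key !![0, 0, 1; 3/5, -4/5, 0; 4/5, 3/5, 0]
    · ext i j; fin_cases i <;> fin_cases j <;> simp [Matrix.mul_apply, Fin.sum_univ_three] <;> norm_num
    · simp [Matrix.det_fin_three] <;> norm_num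
    · ext i j; fin_cases i <;> fin_cases j <;> simp [mkS, Matrix.mul_apply, Fin.sum_univ_three] <;> norm_num
  ext1 E
  obtain ⟨a, b, c, d, e, f, rfl⟩ := exists_mkS E
  have : mkS a b c d e f = (a - 9/12*d - 9/12*e) • mkS 1 0 0 0 0 0
      + (b - 16/12*d - 9/12*f) • mkS 0 1 0 0 0 0 + (c - 16/12*e - 16/12*f) • mkS 0 0 1 0 0 0
      + (25/12*d) • mkS (9/25) (16/25) 0 (12/25) 0 0
      + (25/12*e) • mkS (9/25) 0 (16/25) 0 (12/25) 0
      + (25/12*f) • mkS 0 (9/25) (16/25) 0 0 (12/25) := by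
    apply Subtype.ext
    ext i j
    fin_cases i <;> fin_cases j <;> simp [mkS] <;> ring
  rw [this]
  simp only [map_add, map_smul, h1, h2, h3, h4, h5, h6, smul_zero, add_zero, LinearMap.zero_apply]

theorem D1_image {C : Sym3 →ₗ[ℝ] Sym3} (hC : Equivar C) :
    ∃ p q, C (mkS 1 0 0 0 0 0) = mkS p q q 0 0 0 := by
  obtain ⟨a, b, c, d, e, f, hE⟩ := exists_mkS (C (mkS 1 0 0 0 0 0))
  have k1 := hC.conj !![1, 0, 0; 0, -1, 0; 0, 0, -1] (by ext i j; fin_cases i <;> fin_cases j <;> simp [Matrix.mul_apply, Fin.sum_univ_three] <;> norm_num) (by simp [Matrix.det_fin_three])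
    (mkS 1 0 0 0 0 0) (mkS 1 0 0 0 0 0) (by ext i j; fin_cases i <;> fin_cases j <;> simp [mkS, Matrix.mul_apply, Fin.sum_univ_three] <;> norm_num)
  have k2 := hC.conj !![1, 0, 0; 0, 0, -1; 0, 1, 0] (by ext i j; fin_cases i <;> fin_cases j <;> simp [Matrix.mul_apply, Fin.sum_univ_three] <;> norm_num) (by simp [Matrix.det_fin_three])
    (mkS 1 0 0 0 0 0) (mkS 1 0 0 0 0 0) (by ext i j; fin_cases i <;> fin_cases j <;> simp [mkS, Matrix.mul_apply, Fin.sum_univ_three] <;> norm_num)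
  rw [hE] at k1 k2
  have e1 := congrFun (congrFun k1 0) 1
  have e2 := congrFun (congrFun k1 0) 2
  have e3 := congrFun (congrFun k2 1) 2
  have e4 := congrFun (congrFun k2 1) 1
  simp [mkS, Matrix.mul_apply, Fin.sum_univ_three, Matrix.vecMul, dotProduct] at e1 e2 e3 e4
  obtain rfl : d = 0 := by linarith
  obtain rfl : e = 0 := by linarith
  obtain rfl : f = 0 := by linarith
  obtain rfl : b = c := by linarith
  exact ⟨a, b, hE⟩

theorem equivar_iff (C : Sym3 →ₗ[ℝ] Sym3) :
    Equivar C ↔ ∃ a b : ℝ, a • LinearMap.id + b • trMap = C := by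
  constructor
  · intro hC
    obtain ⟨p, q, h⟩ := D1_image hC
    refine ⟨p - q, q, ?_⟩
    have := ker_of_D1 (hC.sub (equivar_comb (p - q) q)) (by
      rw [LinearMap.sub_apply, h]
      apply Subtype.ext
      ext i j
      fin_cases i <;> fin_cases j <;> simp [trMap, mkS, Matrix.trace_fin_three])
    exact (sub_eq_zero.mp this).symm
  · rintro ⟨a, b, rfl⟩
    exact equivar_comb a b

theorem indep : LinearIndependent ℝ ![(LinearMap.id : Sym3 →ₗ[ℝ] Sym3), trMap] := by
  refine (LinearIndependent.pair_iff (R := ℝ) (M := Sym3 →ₗ[ℝ] Sym3) (x := LinearMap.id) (y := trMap)).mpr ?_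
  intro a b h
  have h1 := congrArg (fun C : Sym3 →ₗ[ℝ] Sym3 => (C (mkS 1 0 0 0 0 0)).1 0 0) h
  have h2 := congrArg (fun C : Sym3 →ₗ[ℝ] Sym3 => (C (mkS 1 0 0 0 0 0)).1 1 1) h
  simp [trMap, mkS, Matrix.trace_fin_three] at h1 h2
  constructor <;> linarith

theorem isotropic_elasticity_tensors_finrank_two :
    ∃ S : Submodule ℝ (Sym3 →ₗ[ℝ] Sym3),
      (∀ C : Sym3 →ₗ[ℝ] Sym3, C ∈ S ↔
        (∀ Q : Matrix (Fin 3) (Fin 3) ℝ, Qᵀ * Q = 1 → Q.det = 1 →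
          ∀ (E : Sym3) (hE : Q * (E : Matrix (Fin 3) (Fin 3) ℝ) * Qᵀ ∈ Sym3),
            ((C ⟨Q * (E : Matrix (Fin 3) (Fin 3) ℝ) * Qᵀ, hE⟩ : Sym3) : Matrix (Fin 3) (Fin 3) ℝ)
              = Q * ((C E : Sym3) : Matrix (Fin 3) (Fin 3) ℝ) * Qᵀ)) ∧
      Module.finrank ℝ ↥S = 2 := by
  refine ⟨Submodule.span ℝ {LinearMap.id, trMap}, fun C => ?_, ?_⟩
  · rw [Submodule.mem_span_pair]
    exact (equivar_iff C).symm
  · have := finrank_span_eq_card indep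
    have hr : Set.range ![(LinearMap.id : Sym3 →ₗ[ℝ] Sym3), trMap] = {LinearMap.id, trMap} := by
      simp [Matrix.range_cons, Matrix.range_empty, Set.pair_comm]
    rw [hr, Fintype.card_fin] at this
    exact this
end

section
/- Let 𝕋² be the subspace of (Fin 3 → Fin 3 → Fin 3 → ℝ) consisting of T with T i j k = T j i k for all i, j, k, with SO(3) acting by (Q • T) i j k = ∑ p q r, Q i p * Q j q * Q k r * T p q r, and with inner product ⟨T, T'⟩ = ∑ i j k, T i j k * T' i j k. The set of linear endomorphisms A of 𝕋² that are equivariant (A (Q • T) = Q • (A T) for all Q ∈ SO(3), T ∈ 𝕋²) and self-adjoint (⟨A T, T'⟩ = ⟨T, A T'⟩ for all T, T') is an ℝ-submodule of the endomorphisms of 𝕋² of finrank exactly 5. -/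
open Matrix

/-- The space 𝕋² of third-order tensors symmetric in their first two indices. -/
def T2 : Submodule ℝ (Fin 3 → Fin 3 → Fin 3 → ℝ) where
  carrier := {T | ∀ i j k, T i j k = T j i k}
  add_mem' := by
    intro a b ha hb i j k
    simp only [Pi.add_apply]
    rw [ha i j k, hb i j k]
  zero_mem' := by intro i j k; rfl
  smul_mem' := by
    intro c a ha i j k
    simp only [Pi.smul_apply, smul_eq_mul]
    rw [ha i j k]

/-- The action of a 3×3 matrix on third-order tensors. -/
def act (Q : Matrix (Fin 3) (Fin 3) ℝ) (T : Fin 3 → Fin 3 → Fin 3 → ℝ) :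
    Fin 3 → Fin 3 → Fin 3 → ℝ :=
  fun i j k => ∑ p : Fin 3, ∑ q : Fin 3, ∑ r : Fin 3, Q i p * Q j q * Q k r * T p q r

/-- The natural inner product on third-order tensors. -/
def innerT (T T' : Fin 3 → Fin 3 → Fin 3 → ℝ) : ℝ :=
  ∑ i : Fin 3, ∑ j : Fin 3, ∑ k : Fin 3, T i j k * T' i j k

/-- Helper instance (definitionally the standard one; typeclass search fails to find it
due to a unification issue with nested submodules). -/
noncomputable instance (S : Submodule ℝ (T2 →ₗ[ℝ] T2)) : AddCommGroup ↥S :=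
  @Submodule.addCommGroup ℝ (T2 →ₗ[ℝ] T2) _ _ _ S

open Finset in
lemma act_nested (Q : Matrix (Fin 3) (Fin 3) ℝ) (T : Fin 3 → Fin 3 → Fin 3 → ℝ) (i j k : Fin 3) :
    act Q T i j k = ∑ p, Q i p * ∑ q, Q j q * ∑ r, Q k r * T p q r := by
  simp only [act, Finset.mul_sum, mul_assoc]

lemma sum_swap3 (f g : Fin 3 → ℝ) (h : Fin 3 → Fin 3 → ℝ) :
    ∑ c, f c * ∑ p, g p * h c p = ∑ p, g p * ∑ c, f c * h c p := by
  simp only [Finset.mul_sum]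
  rw [Finset.sum_comm]
  exact Finset.sum_congr rfl fun _ _ => Finset.sum_congr rfl fun _ _ => by ring

lemma orth_cols {Q : Matrix (Fin 3) (Fin 3) ℝ} (hQ : Qᵀ * Q = 1) (p q : Fin 3) :
    ∑ a, Q a p * Q a q = if p = q then 1 else 0 := by
  have := congrFun (congrFun hQ p) q
  simpa [Matrix.mul_apply, Matrix.one_apply] using this

lemma orth_rows {Q : Matrix (Fin 3) (Fin 3) ℝ} (hQ : Qᵀ * Q = 1) (p q : Fin 3) :
    ∑ a, Q p a * Q q a = if p = q then 1 else 0 := by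
  have h2 : Q * Qᵀ = 1 := mul_eq_one_comm.mp hQ
  have := congrFun (congrFun h2 p) q
  simpa [Matrix.mul_apply, Matrix.one_apply] using this

lemma orth_contract {Q : Matrix (Fin 3) (Fin 3) ℝ} (hQ : Qᵀ * Q = 1) (i : Fin 3)
    (f : Fin 3 → ℝ) : ∑ a, Q a i * ∑ p, Q a p * f p = f i := by
  have h : ∑ a, Q a i * ∑ p, Q a p * f p = ∑ p, (∑ a, Q a i * Q a p) * f p := by
    simp only [Finset.mul_sum, Finset.sum_mul]
    rw [Finset.sum_comm]
    exact Finset.sum_congr rfl fun _ _ => Finset.sum_congr rfl fun _ _ => by ring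
  rw [h]; simp [orth_cols hQ]

lemma act_transpose_act {Q : Matrix (Fin 3) (Fin 3) ℝ} (hQ : Qᵀ * Q = 1)
    (X : Fin 3 → Fin 3 → Fin 3 → ℝ) : act Qᵀ (act Q X) = X := by
  funext i j k
  have h1 : ∀ a b, ∑ c, Q c k * act Q X a b c = ∑ p, Q a p * ∑ q, Q b q * X p q k := by
    intro a b
    simp only [act_nested]
    rw [sum_swap3]
    refine Finset.sum_congr rfl fun p _ => ?_
    rw [sum_swap3]
    congr 1
    refine Finset.sum_congr rfl fun q _ => ?_
    rw [orth_contract hQ]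
  have h2 : ∀ a, ∑ b, Q b j * ∑ c, Q c k * act Q X a b c = ∑ p, Q a p * X p j k := by
    intro a
    simp only [h1]
    rw [sum_swap3]
    refine Finset.sum_congr rfl fun p _ => ?_
    rw [orth_contract hQ]
  rw [act_nested]
  simp only [Matrix.transpose_apply, h2]
  rw [orth_contract hQ]

/-- Symmetrised basis tensors. -/
def symE (l m n : Fin 3) : T2 :=
  ⟨fun p q r => ((if p = l then 1 else 0) * (if q = m then 1 else 0) +
      (if p = m then 1 else 0) * (if q = l then 1 else 0)) * (if r = n then 1 else 0), by
    intro i j k; ring⟩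

lemma symE_apply (l m n p q r : Fin 3) : (symE l m n : Fin 3 → Fin 3 → Fin 3 → ℝ) p q r =
    ((if p = l then 1 else 0) * (if q = m then 1 else 0) +
      (if p = m then 1 else 0) * (if q = l then 1 else 0)) * (if r = n then 1 else 0) := rfl

lemma symE_comm (l m n : Fin 3) : symE l m n = symE m l n := by
  apply Subtype.ext; funext p q r; simp only [symE_apply]; ring

lemma act_mem (Q : Matrix (Fin 3) (Fin 3) ℝ) (T : T2) :
    act Q (T : Fin 3 → Fin 3 → Fin 3 → ℝ) ∈ T2 := by
  intro i j k
  simp only [act]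
  rw [Finset.sum_comm]
  refine Finset.sum_congr rfl fun p _ => Finset.sum_congr rfl fun q _ =>
    Finset.sum_congr rfl fun r _ => ?_
  rw [T.2 q p r]; ring

lemma T2_expand (T : T2) : T = ∑ p, ∑ q, ∑ r,
    ((T : Fin 3 → Fin 3 → Fin 3 → ℝ) p q r / 2) • symE p q r := by
  apply Subtype.ext; funext i j k
  have := T.2 i j k
  simp only [Submodule.coe_sum, Finset.sum_apply, Submodule.coe_smul, Pi.smul_apply, symE_apply,
    smul_eq_mul, mul_add, add_mul, Finset.sum_add_distrib]
  simp
  linarith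

lemma act_symE (Q : Matrix (Fin 3) (Fin 3) ℝ) (l m n : Fin 3) :
    (⟨act Q (symE l m n : Fin 3 → Fin 3 → Fin 3 → ℝ), act_mem Q _⟩ : T2) =
      ∑ p, Q p l • ∑ q, Q q m • ∑ r, Q r n • symE p q r := by
  apply Subtype.ext; funext i j k
  simp only [act_nested, Submodule.coe_sum, Finset.sum_apply, Submodule.coe_smul, Pi.smul_apply,
    symE_apply, smul_eq_mul, mul_add, add_mul, Finset.sum_add_distrib]
  simp
  ring

/-- Six-index component array of an endomorphism. -/
noncomputable def cmpA (A : T2 →ₗ[ℝ] T2) (i j k l m n : Fin 3) : ℝ :=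
  (A (symE l m n) : Fin 3 → Fin 3 → Fin 3 → ℝ) i j k

/-- Invariance of a six-index array. -/
def Inv6 (N : Fin 3 → Fin 3 → Fin 3 → Fin 3 → Fin 3 → Fin 3 → ℝ) : Prop :=
  ∀ Q : Matrix (Fin 3) (Fin 3) ℝ, Qᵀ * Q = 1 → Q.det = 1 → ∀ i j k l m n,
    N i j k l m n = ∑ a, Q a i * ∑ b, Q b j * ∑ c, Q c k *
      ∑ p, Q p l * ∑ q, Q q m * ∑ r, Q r n * N a b c p q r

/-- Equivariance. -/
def Equi (A : T2 →ₗ[ℝ] T2) : Prop :=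
  ∀ Q : Matrix (Fin 3) (Fin 3) ℝ, Qᵀ * Q = 1 → Q.det = 1 →
    ∀ (T : T2) (h : act Q (T : Fin 3 → Fin 3 → Fin 3 → ℝ) ∈ T2),
      ((A ⟨act Q (T : Fin 3 → Fin 3 → Fin 3 → ℝ), h⟩ : T2) : Fin 3 → Fin 3 → Fin 3 → ℝ)
        = act Q ((A T : T2) : Fin 3 → Fin 3 → Fin 3 → ℝ)

/-- Self-adjointness. -/
def SelfAdj (A : T2 →ₗ[ℝ] T2) : Prop :=
  ∀ T T' : T2, innerT ((A T : T2) : Fin 3 → Fin 3 → Fin 3 → ℝ) (T' : Fin 3 → Fin 3 → Fin 3 → ℝ)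
    = innerT (T : Fin 3 → Fin 3 → Fin 3 → ℝ) ((A T' : T2) : Fin 3 → Fin 3 → Fin 3 → ℝ)

lemma Equi.inv6 {A : T2 →ₗ[ℝ] T2} (hA : Equi A) : Inv6 (cmpA A) := by
  intro Q hQ hd i j k l m n
  have h := hA Q hQ hd (symE l m n) (act_mem Q _)
  have h2 := congrFun (congrFun (congrFun (congrArg (act Qᵀ) h) i) j) k
  rw [act_transpose_act hQ, act_symE] at h2
  rw [cmpA, ← h2, act_nested]
  simp [map_sum, Finset.sum_apply, cmpA]

lemma cmpA_symm1 (A : T2 →ₗ[ℝ] T2) (i j k l m n : Fin 3) :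
    cmpA A i j k l m n = cmpA A j i k l m n := (A (symE l m n)).2 i j k

lemma cmpA_symm2 (A : T2 →ₗ[ℝ] T2) (i j k l m n : Fin 3) :
    cmpA A i j k l m n = cmpA A i j k m l n := by rw [cmpA, symE_comm]; rfl

lemma innerT_symE (T : T2) (i j k : Fin 3) :
    innerT (T : Fin 3 → Fin 3 → Fin 3 → ℝ) (symE i j k : Fin 3 → Fin 3 → Fin 3 → ℝ) =
      2 * (T : Fin 3 → Fin 3 → Fin 3 → ℝ) i j k := by
  have := T.2 i j k
  simp only [innerT, symE_apply, mul_add, add_mul, Finset.sum_add_distrib]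
  simp
  linarith

lemma innerT_comm (T T' : Fin 3 → Fin 3 → Fin 3 → ℝ) : innerT T T' = innerT T' T := by
  simp only [innerT, mul_comm]

lemma SelfAdj.cmpA_symm {A : T2 →ₗ[ℝ] T2} (hA : SelfAdj A) (i j k l m n : Fin 3) :
    cmpA A i j k l m n = cmpA A l m n i j k := by
  have h := hA (symE l m n) (symE i j k)
  rw [innerT_symE, innerT_comm, innerT_symE] at h
  simp only [cmpA]; linarith

lemma eq_of_cmpA {A B : T2 →ₗ[ℝ] T2} (h : ∀ i j k l m n, cmpA A i j k l m n = cmpA B i j k l m n) :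
    A = B := by
  have h' : ∀ l m n, A (symE l m n) = B (symE l m n) := by
    intro l m n
    apply Subtype.ext; funext i j k
    exact h i j k l m n
  ext1 T
  rw [T2_expand T]
  simp only [map_sum, map_smul, h']

lemma Inv6.perm {N} (hN : Inv6 N) (σ : Equiv.Perm (Fin 3)) (hσ : Equiv.Perm.sign σ = -1)
    (i j k l m n : Fin 3) : N i j k l m n = N (σ i) (σ j) (σ k) (σ l) (σ m) (σ n) := by
  have h := hN (Matrix.of fun p l => if p = σ l then -1 else 0) ?_ ?_ i j k l m n
  · simpa using h
  · ext a b
    by_cases h : a = b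
    · simp [Matrix.mul_apply, Matrix.one_apply, h]
    · simp [Matrix.mul_apply, Matrix.one_apply, h, Ne.symm h]
  · have : (Matrix.of fun p l => if p = σ l then (-1:ℝ) else 0) = -(σ.permMatrix ℝ)ᵀ := by
      ext a b
      simp only [Matrix.of_apply, Matrix.neg_apply, Matrix.transpose_apply,
        Equiv.Perm.permMatrix, PEquiv.toMatrix_apply, Equiv.toPEquiv_apply, Option.mem_def, Option.some.injEq]
      split_ifs <;> simp_all
    rw [this, Matrix.det_neg, Matrix.det_transpose, Matrix.det_permutation, hσ]
    norm_num

lemma Inv6.diag {N} (hN : Inv6 N) (s : Fin 3 → ℝ) (hs : ∀ i, s i * s i = 1) (hs' : s 0 * s 1 * s 2 = 1)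
    (i j k l m n : Fin 3) : N i j k l m n = s i * (s j * (s k * (s l * (s m * (s n * N i j k l m n))))) := by
  have h := hN (Matrix.diagonal s) ?_ ?_ i j k l m n
  · simpa [Matrix.diagonal_apply] using h
  · simp [hs]
  · simp [Matrix.det_diagonal, Fin.prod_univ_three, hs']

/-- A rational rotation about the third axis. -/
noncomputable def rotQ : Matrix (Fin 3) (Fin 3) ℝ := !![3/5, -4/5, 0; 4/5, 3/5, 0; 0, 0, 1]

lemma Inv6.rot {N} (hN : Inv6 N) (i j k l m n : Fin 3) :
    N i j k l m n = ∑ a, rotQ a i * ∑ b, rotQ b j * ∑ c, rotQ c k *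
      ∑ p, rotQ p l * ∑ q, rotQ q m * ∑ r, rotQ r n * N a b c p q r := by
  apply hN
  · ext a b
    fin_cases a <;> fin_cases b <;> simp [rotQ, Matrix.mul_apply, Fin.sum_univ_three] <;> norm_num
  · simp [rotQ, Matrix.det_fin_three]; norm_num

/-- Evaluation of a six-index array on a list of indices. -/
def evL (N : Fin 3 → Fin 3 → Fin 3 → Fin 3 → Fin 3 → Fin 3 → ℝ) : List (Fin 3) → ℝ
  | [a, b, c, d, e, f] => N a b c d e f
  | _ => 0

/-- Images of an index string under the index symmetries. -/
def variants (i j k l m n : Fin 3) : List (List (Fin 3)) :=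
  [[i, j, k, l, m, n], [j, i, k, l, m, n], [i, j, k, m, l, n], [j, i, k, m, l, n],
   [l, m, n, i, j, k], [l, m, n, j, i, k], [m, l, n, i, j, k], [m, l, n, j, i, k]]

/-- The permutations of three letters. -/
def perms3 : List (Equiv.Perm (Fin 3)) :=
  [1, Equiv.swap 0 1, Equiv.swap 0 2, Equiv.swap 1 2, Equiv.swap 0 1 * Equiv.swap 1 2,
    Equiv.swap 1 2 * Equiv.swap 0 1]

/-- Some letter occurs an odd number of times. -/
def oddStr (i j k l m n : Fin 3) : Bool :=
  (List.finRange 3).any fun v => ([i, j, k, l, m, n].count v) % 2 == 1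

/-- The string reduces, by symmetry, to one in the list. -/
def reduces (L : List (List (Fin 3))) (i j k l m n : Fin 3) : Bool :=
  perms3.any fun σ => (variants (σ i) (σ j) (σ k) (σ l) (σ m) (σ n)).any fun v => L.contains v

lemma Inv6.perm_all {N} (hN : Inv6 N) (σ : Equiv.Perm (Fin 3))
    (i j k l m n : Fin 3) : N i j k l m n = N (σ i) (σ j) (σ k) (σ l) (σ m) (σ n) := by
  rcases Int.units_eq_one_or (Equiv.Perm.sign σ) with h | h
  · rw [hN.perm (Equiv.swap (0 : Fin 3) 1 * σ) (by simp [h]),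
      hN.perm (Equiv.swap (0 : Fin 3) 1) (by simp)]
    simp
  · exact hN.perm σ h i j k l m n

lemma Inv6.odd_zero {N} (hN : Inv6 N) (i j k l m n : Fin 3) (h : oddStr i j k l m n = true) :
    N i j k l m n = 0 := by
  simp only [oddStr, List.any_eq_true] at h
  obtain ⟨v, -, h⟩ := h
  have hd := hN.diag (fun x => if x = v then 1 else -1) (by intro x; split_ifs <;> norm_num)
    (by fin_cases v <;> simp) i j k l m n
  simp only [List.count_cons, List.count_nil, beq_iff_eq] at h
  by_cases h1 : i = v <;> by_cases h2 : j = v <;> by_cases h3 : k = v <;>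
  by_cases h4 : l = v <;> by_cases h5 : m = v <;> by_cases h6 : n = v <;>
  simp only [h1, h2, h3, h4, h5, h6, if_true, if_false] at h hd ⊢ <;>
  first
  | (exfalso; revert h; decide)
  | linarith

/-- Index symmetries. -/
structure Sym6 (N : Fin 3 → Fin 3 → Fin 3 → Fin 3 → Fin 3 → Fin 3 → ℝ) : Prop where
  s1 : ∀ i j k l m n, N i j k l m n = N j i k l m n
  s2 : ∀ i j k l m n, N i j k l m n = N i j k m l n
  s3 : ∀ i j k l m n, N i j k l m n = N l m n i j k

lemma Sym6.variant {N} (h : Sym6 N) (i j k l m n : Fin 3) (v) (hv : v ∈ variants i j k l m n) :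
    evL N v = N i j k l m n := by
  simp only [variants, List.mem_cons, List.not_mem_nil, or_false] at hv
  rcases hv with rfl | rfl | rfl | rfl | rfl | rfl | rfl | rfl <;> simp only [evL]
  · exact h.s1 _ _ _ _ _ _
  · exact h.s2 _ _ _ _ _ _
  · rw [h.s1, h.s2]
  · exact h.s3 _ _ _ _ _ _
  · rw [h.s3, h.s1]
  · rw [h.s3, h.s2]
  · rw [h.s3, h.s2, h.s1]

lemma reduce_zero {N} (hN : Inv6 N) (hS : Sym6 N) (L : List (List (Fin 3)))
    (hL : ∀ v ∈ L, evL N v = 0) (i j k l m n : Fin 3)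
    (h : (oddStr i j k l m n || reduces L i j k l m n) = true) : N i j k l m n = 0 := by
  rw [Bool.or_eq_true] at h
  rcases h with h | h
  · exact hN.odd_zero _ _ _ _ _ _ h
  · simp only [reduces, List.any_eq_true, List.contains_iff_mem] at h
    obtain ⟨σ, -, v, hv, hvL⟩ := h
    rw [hN.perm_all σ, ← hS.variant _ _ _ _ _ _ v hv]
    exact hL v hvL

/-- Canonical strings with all three letters. -/
def L222 : List (List (Fin 3)) :=
  [[0,1,2,0,1,2], [0,1,2,0,2,1], [0,0,1,2,2,1], [0,0,1,1,2,2], [0,1,0,1,2,2]]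

/-- Canonical strings with two letters or three. -/
def L42 : List (List (Fin 3)) :=
  [[2,2,0,0,0,0], [2,0,2,0,0,0], [0,0,2,0,0,2], [2,0,0,2,0,0], [2,0,0,0,0,2]] ++ L222

set_option maxRecDepth 100000 in
lemma all_reduce : ∀ i j k l m n : Fin 3,
    (oddStr i j k l m n || reduces ([0,0,0,0,0,0] :: L42) i j k l m n) = true := by
  decide +kernel

lemma Inv6.eq_zero {N} (hN : Inv6 N) (hS : Sym6 N) (h0 : ∀ v ∈ L222, evL N v = 0)
    (i j k l m n : Fin 3) : N i j k l m n = 0 := by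
  have z1 := reduce_zero hN hS L222 h0
  have sw := hN.perm_all (Equiv.swap (0 : Fin 3) 1)
  have e2 : Equiv.swap (0 : Fin 3) 1 2 = 2 := by decide
  have h42 : ∀ v ∈ L42, evL N v = 0 := by
    intro v hv
    rw [L42, List.mem_append] at hv
    rcases hv with hv | hv
    · simp only [List.mem_cons, List.not_mem_nil, or_false] at hv
      rcases hv with rfl | rfl | rfl | rfl | rfl <;> simp only [evL]
      · have h := hN.rot 2 2 0 0 0 1
        have s := sw 2 2 0 0 0 0
        simp [rotQ, Fin.sum_univ_three, e2] at h s
        simp +decide [z1] at h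
        linarith
      · have h := hN.rot 2 0 2 0 0 1
        have s := sw 2 0 2 0 0 0
        simp [rotQ, Fin.sum_univ_three, e2] at h s
        simp +decide [z1] at h
        linarith
      · have h := hN.rot 0 0 2 0 1 2
        have s := sw 0 0 2 0 0 2
        simp [rotQ, Fin.sum_univ_three, e2] at h s
        simp +decide [z1] at h
        linarith
      · have h := hN.rot 2 0 0 2 0 1
        have s := sw 2 0 0 2 0 0
        simp [rotQ, Fin.sum_univ_three, e2] at h s
        simp +decide [z1] at h
        linarith
      · have h := hN.rot 2 0 0 0 1 2
        have s := sw 2 0 0 0 0 2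
        simp [rotQ, Fin.sum_univ_three, e2] at h s
        simp +decide [z1] at h
        linarith
    · exact h0 v hv
  have z2 := reduce_zero hN hS L42 h42
  have h6 : N 0 0 0 0 0 0 = 0 := by
    have h := hN.rot 0 0 0 0 0 1
    have s := sw 0 0 0 0 0 0
    simp [rotQ, Fin.sum_univ_three] at h s
    simp +decide [z2] at h
    linarith
  refine reduce_zero hN hS ([0,0,0,0,0,0] :: L42) ?_ i j k l m n (all_reduce i j k l m n)
  intro v hv
  rcases List.mem_cons.mp hv with rfl | hv
  · exact h6
  · exact h42 v hv

/-- The general isotropic law, as a raw formula. -/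
def lawF (c : Fin 5 → ℝ) (T : Fin 3 → Fin 3 → Fin 3 → ℝ) : Fin 3 → Fin 3 → Fin 3 → ℝ :=
  fun i j k => c 0 * T i j k + c 1 * (T i k j + T j k i)
    + c 2 * ((if i = j then 1 else 0) * ∑ l, T l l k)
    + c 3 * (2 * ((if i = j then 1 else 0) * ∑ l, T k l l) + (if i = k then 1 else 0) * ∑ l, T l l j
        + (if j = k then 1 else 0) * ∑ l, T l l i)
    + c 4 * ((if i = k then 1 else 0) * ∑ l, T j l l + (if j = k then 1 else 0) * ∑ l, T i l l)

lemma lawF_mem (c : Fin 5 → ℝ) (T : T2) : lawF c (T : Fin 3 → Fin 3 → Fin 3 → ℝ) ∈ T2 := by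
  intro i j k
  simp only [lawF]
  have e : (if i = j then (1 : ℝ) else 0) = if j = i then 1 else 0 := by simp only [eq_comm]
  rw [T.2 i j k, e]
  ring

/-- The general isotropic law. -/
def law : (Fin 5 → ℝ) →ₗ[ℝ] T2 →ₗ[ℝ] T2 :=
  LinearMap.mk₂ ℝ (fun c T => ⟨lawF c T, lawF_mem c T⟩)
    (by intro c d T; apply Subtype.ext; funext i j k; simp only [lawF, Submodule.coe_add, Submodule.coe_smul, Pi.add_apply, Pi.smul_apply, smul_eq_mul, Finset.sum_add_distrib, ← Finset.mul_sum]; ring)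
    (by intro a c T; apply Subtype.ext; funext i j k; simp only [lawF, Submodule.coe_add, Submodule.coe_smul, Pi.add_apply, Pi.smul_apply, smul_eq_mul, Finset.sum_add_distrib, ← Finset.mul_sum]; ring)
    (by intro c T T'; apply Subtype.ext; funext i j k; simp only [lawF, Submodule.coe_add, Submodule.coe_smul, Pi.add_apply, Pi.smul_apply, smul_eq_mul, Finset.sum_add_distrib, ← Finset.mul_sum]; ring)
    (by intro a c T; apply Subtype.ext; funext i j k; simp only [lawF, Submodule.coe_add, Submodule.coe_smul, Pi.add_apply, Pi.smul_apply, smul_eq_mul, Finset.sum_add_distrib, ← Finset.mul_sum]; ring)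

lemma law_apply (c : Fin 5 → ℝ) (T : T2) :
    (law c T : Fin 3 → Fin 3 → Fin 3 → ℝ) = lawF c T := rfl

lemma law_selfAdj (c : Fin 5 → ℝ) : SelfAdj (law c) := by
  intro T T'
  simp only [law_apply]
  have h1 : ∀ k, (T : Fin 3 → Fin 3 → Fin 3 → ℝ) 1 0 k = (T : Fin 3 → Fin 3 → Fin 3 → ℝ) 0 1 k := fun k => T.2 _ _ _
  have h2 : ∀ k, (T : Fin 3 → Fin 3 → Fin 3 → ℝ) 2 0 k = (T : Fin 3 → Fin 3 → Fin 3 → ℝ) 0 2 k := fun k => T.2 _ _ _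
  have h3 : ∀ k, (T : Fin 3 → Fin 3 → Fin 3 → ℝ) 2 1 k = (T : Fin 3 → Fin 3 → Fin 3 → ℝ) 1 2 k := fun k => T.2 _ _ _
  have g1 : ∀ k, (T' : Fin 3 → Fin 3 → Fin 3 → ℝ) 1 0 k = (T' : Fin 3 → Fin 3 → Fin 3 → ℝ) 0 1 k := fun k => T'.2 _ _ _
  have g2 : ∀ k, (T' : Fin 3 → Fin 3 → Fin 3 → ℝ) 2 0 k = (T' : Fin 3 → Fin 3 → Fin 3 → ℝ) 0 2 k := fun k => T'.2 _ _ _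
  have g3 : ∀ k, (T' : Fin 3 → Fin 3 → Fin 3 → ℝ) 2 1 k = (T' : Fin 3 → Fin 3 → Fin 3 → ℝ) 1 2 k := fun k => T'.2 _ _ _
  simp [innerT, lawF, Fin.sum_univ_three, h1, h2, h3, g1, g2, g3]
  ring

lemma trace12_act {Q : Matrix (Fin 3) (Fin 3) ℝ} (hQ : Qᵀ * Q = 1)
    (T : Fin 3 → Fin 3 → Fin 3 → ℝ) (k : Fin 3) :
    ∑ l, act Q T l l k = ∑ r, Q k r * ∑ l, T l l r := by
  have h : ∀ l, act Q T l l k = ∑ p, Q l p * ∑ q, Q l q * ∑ r, Q k r * T p q r :=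
    fun l => act_nested Q T l l k
  have h2 : ∑ l, act Q T l l k = ∑ p, ∑ q, (∑ l, Q l p * Q l q) * ∑ r, Q k r * T p q r := by
    simp only [h, Finset.sum_mul]
    rw [Finset.sum_comm]
    refine Finset.sum_congr rfl fun p _ => ?_
    rw [Finset.sum_comm]
    refine Finset.sum_congr rfl fun l _ => ?_
    rw [Finset.mul_sum]
    exact Finset.sum_congr rfl fun _ _ => by ring
  rw [h2]
  simp only [orth_cols hQ, ite_mul, one_mul, zero_mul, Finset.sum_ite_eq, Finset.mem_univ, if_true]
  rw [Finset.sum_comm]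
  simp only [Finset.mul_sum]

lemma act_cycle (Q : Matrix (Fin 3) (Fin 3) ℝ) (T : Fin 3 → Fin 3 → Fin 3 → ℝ) (i j k : Fin 3) :
    act Q (fun a b c => T b c a) i j k = act Q T j k i := by
  simp only [act]
  rw [Finset.sum_comm]
  refine Finset.sum_congr rfl fun p _ => ?_
  rw [Finset.sum_comm]
  refine Finset.sum_congr rfl fun q _ => Finset.sum_congr rfl fun r _ => by ring

lemma act_swap23 (Q : Matrix (Fin 3) (Fin 3) ℝ) (T : Fin 3 → Fin 3 → Fin 3 → ℝ) (i j k : Fin 3) :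
    act Q (fun a b c => T a c b) i j k = act Q T i k j := by
  simp only [act]
  refine Finset.sum_congr rfl fun p _ => ?_
  rw [Finset.sum_comm]
  refine Finset.sum_congr rfl fun q _ => Finset.sum_congr rfl fun r _ => by ring

lemma trace23_act {Q : Matrix (Fin 3) (Fin 3) ℝ} (hQ : Qᵀ * Q = 1)
    (T : Fin 3 → Fin 3 → Fin 3 → ℝ) (k : Fin 3) :
    ∑ l, act Q T k l l = ∑ r, Q k r * ∑ l, T r l l := by
  have := trace12_act hQ (fun a b c => T c a b) k
  rw [← this]
  refine Finset.sum_congr rfl fun l _ => ?_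
  exact act_cycle Q (fun a b c => T c a b) k l l

lemma act_delta12 {Q : Matrix (Fin 3) (Fin 3) ℝ} (hQ : Qᵀ * Q = 1)
    (w : Fin 3 → ℝ) (i j k : Fin 3) :
    act Q (fun a b c => (if a = b then 1 else 0) * w c) i j k =
      (if i = j then 1 else 0) * ∑ r, Q k r * w r := by
  rw [act_nested, ← orth_rows hQ i j, Finset.sum_mul]
  refine Finset.sum_congr rfl fun p _ => ?_
  simp [mul_assoc, ← Finset.mul_sum]

lemma act_delta13 {Q : Matrix (Fin 3) (Fin 3) ℝ} (hQ : Qᵀ * Q = 1)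
    (w : Fin 3 → ℝ) (i j k : Fin 3) :
    act Q (fun a b c => (if a = c then 1 else 0) * w b) i j k =
      (if i = k then 1 else 0) * ∑ r, Q j r * w r := by
  rw [← act_delta12 hQ w i k j]
  exact act_swap23 Q (fun a b c => (if a = b then 1 else 0) * w c) i j k

lemma act_delta23 {Q : Matrix (Fin 3) (Fin 3) ℝ} (hQ : Qᵀ * Q = 1)
    (w : Fin 3 → ℝ) (i j k : Fin 3) :
    act Q (fun a b c => (if b = c then 1 else 0) * w a) i j k =
      (if j = k then 1 else 0) * ∑ r, Q i r * w r := by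
  rw [← act_delta12 hQ w j k i]
  exact act_cycle Q (fun a b c => (if a = b then 1 else 0) * w c) i j k

lemma act_add' (Q : Matrix (Fin 3) (Fin 3) ℝ) (f g : Fin 3 → Fin 3 → Fin 3 → ℝ) (i j k : Fin 3) :
    act Q (fun a b c => f a b c + g a b c) i j k = act Q f i j k + act Q g i j k := by
  simp only [act, mul_add, Finset.sum_add_distrib]

lemma act_smul' (Q : Matrix (Fin 3) (Fin 3) ℝ) (x : ℝ) (f : Fin 3 → Fin 3 → Fin 3 → ℝ) (i j k : Fin 3) :
    act Q (fun a b c => x * f a b c) i j k = x * act Q f i j k := by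
  simp only [act, Finset.mul_sum]
  exact Finset.sum_congr rfl fun _ _ => Finset.sum_congr rfl fun _ _ =>
    Finset.sum_congr rfl fun _ _ => by ring

lemma law_equi (c : Fin 5 → ℝ) : Equi (law c) := by
  intro Q hQ _ T h
  simp only [law_apply]
  generalize (T : Fin 3 → Fin 3 → Fin 3 → ℝ) = X
  funext i j k
  have e1 : act Q (lawF c X) i j k = c 0 * act Q X i j k + c 1 * (act Q X i k j + act Q X j k i)
    + c 2 * ((if i = j then 1 else 0) * ∑ r, Q k r * ∑ l, X l l r)
    + c 3 * (2 * ((if i = j then 1 else 0) * ∑ r, Q k r * ∑ l, X r l l)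
        + (if i = k then 1 else 0) * ∑ r, Q j r * ∑ l, X l l r
        + (if j = k then 1 else 0) * ∑ r, Q i r * ∑ l, X l l r)
    + c 4 * ((if i = k then 1 else 0) * ∑ r, Q j r * ∑ l, X r l l
        + (if j = k then 1 else 0) * ∑ r, Q i r * ∑ l, X r l l) := by
    unfold lawF
    rw [act_add', act_add', act_add', act_add', act_smul', act_smul', act_smul', act_smul',
      act_smul', act_add', act_add', act_add', act_add', act_smul',
      act_delta12 hQ (fun k => ∑ l, X l l k), act_delta12 hQ (fun k => ∑ l, X k l l),
      act_delta13 hQ (fun k => ∑ l, X l l k), act_delta13 hQ (fun k => ∑ l, X k l l),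
      act_delta23 hQ (fun k => ∑ l, X l l k), act_delta23 hQ (fun k => ∑ l, X k l l)]
    have t1 : act Q (fun a b c => X a c b) i j k = act Q X i k j := act_swap23 Q X i j k
    have t2 : act Q (fun a b c => X b c a) i j k = act Q X j k i := act_cycle Q X i j k
    rw [t1, t2]
  rw [e1]
  simp only [lawF, trace12_act hQ, trace23_act hQ]

lemma Equi.sub {A B : T2 →ₗ[ℝ] T2} (hA : Equi A) (hB : Equi B) : Equi (A - B) := by
  intro Q hQ hd T h
  have h1 := hA Q hQ hd T h
  have h2 := hB Q hQ hd T h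
  simp only [LinearMap.sub_apply, Submodule.coe_sub, h1, h2]
  funext i j k
  simp only [Pi.sub_apply, act, mul_sub, Finset.sum_sub_distrib]

lemma SelfAdj.sub {A B : T2 →ₗ[ℝ] T2} (hA : SelfAdj A) (hB : SelfAdj B) : SelfAdj (A - B) := by
  intro T T'
  have h1 := hA T T'
  have h2 := hB T T'
  simp only [innerT] at h1 h2
  simp only [LinearMap.sub_apply, Submodule.coe_sub, innerT, Pi.sub_apply, mul_sub, sub_mul,
    Finset.sum_sub_distrib, h1, h2]

lemma cmpA_law (c : Fin 5 → ℝ) :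
    cmpA (law c) 0 1 2 0 1 2 = c 0 ∧ cmpA (law c) 0 1 2 0 2 1 = c 1 ∧
    cmpA (law c) 0 0 1 2 2 1 = 2 * c 2 ∧ cmpA (law c) 0 0 1 1 2 2 = 2 * c 3 ∧
    cmpA (law c) 0 1 0 1 2 2 = c 4 := by
  refine ⟨?_, ?_, ?_, ?_, ?_⟩ <;>
    simp [cmpA, law_apply, lawF, symE_apply, Fin.sum_univ_three] <;> ring

lemma law_injective : Function.Injective law := by
  intro c d h
  obtain ⟨c0, c1, c2, c3, c4⟩ := cmpA_law c
  obtain ⟨d0, d1, d2, d3, d4⟩ := cmpA_law d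
  rw [h] at c0 c1 c2 c3 c4
  funext i
  fin_cases i <;> simp <;> linarith

lemma exists_law {A : T2 →ₗ[ℝ] T2} (hE : Equi A) (hS : SelfAdj A) : ∃ c, law c = A := by
  refine ⟨![cmpA A 0 1 2 0 1 2, cmpA A 0 1 2 0 2 1, cmpA A 0 0 1 2 2 1 / 2, cmpA A 0 0 1 1 2 2 / 2,
    cmpA A 0 1 0 1 2 2], ?_⟩
  generalize hc : (![cmpA A 0 1 2 0 1 2, cmpA A 0 1 2 0 2 1, cmpA A 0 0 1 2 2 1 / 2,
    cmpA A 0 0 1 1 2 2 / 2, cmpA A 0 1 0 1 2 2] : Fin 5 → ℝ) = c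
  obtain ⟨c0, c1, c2, c3, c4⟩ := cmpA_law c
  have k0 : c 0 = cmpA A 0 1 2 0 1 2 := by rw [← hc]; rfl
  have k1 : c 1 = cmpA A 0 1 2 0 2 1 := by rw [← hc]; rfl
  have k2 : c 2 = cmpA A 0 0 1 2 2 1 / 2 := by rw [← hc]; rfl
  have k3 : c 3 = cmpA A 0 0 1 1 2 2 / 2 := by rw [← hc]; rfl
  have k4 : c 4 = cmpA A 0 1 0 1 2 2 := by rw [← hc]; rfl
  have hE' := hE.sub (law_equi c)
  have hS' := hS.sub (law_selfAdj c)
  have hsub : ∀ i j k l m n, cmpA (A - law c) i j k l m n =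
      cmpA A i j k l m n - cmpA (law c) i j k l m n := fun _ _ _ _ _ _ => rfl
  have hz := hE'.inv6.eq_zero ⟨cmpA_symm1 _, cmpA_symm2 _, hS'.cmpA_symm⟩ (by
    intro v hv
    simp only [L222, List.mem_cons, List.not_mem_nil, or_false] at hv
    rcases hv with rfl | rfl | rfl | rfl | rfl <;> simp only [evL, hsub] <;> linarith)
  refine eq_of_cmpA fun i j k l m n => ?_
  have := hz i j k l m n
  rw [hsub] at this
  linarith

theorem isotropic_second_order_elasticity_finrank_five :
    ∃ S : Submodule ℝ (T2 →ₗ[ℝ] T2),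
      (∀ A : T2 →ₗ[ℝ] T2, A ∈ S ↔
        ((∀ Q : Matrix (Fin 3) (Fin 3) ℝ, Qᵀ * Q = 1 → Q.det = 1 →
            ∀ (T : T2) (h : act Q (T : Fin 3 → Fin 3 → Fin 3 → ℝ) ∈ T2),
              ((A ⟨act Q (T : Fin 3 → Fin 3 → Fin 3 → ℝ), h⟩ : T2) : Fin 3 → Fin 3 → Fin 3 → ℝ)
                = act Q ((A T : T2) : Fin 3 → Fin 3 → Fin 3 → ℝ)) ∧
          (∀ T T' : T2, innerT ((A T : T2) : Fin 3 → Fin 3 → Fin 3 → ℝ) (T' : Fin 3 → Fin 3 → Fin 3 → ℝ)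
              = innerT (T : Fin 3 → Fin 3 → Fin 3 → ℝ) ((A T' : T2) : Fin 3 → Fin 3 → Fin 3 → ℝ)))) ∧
      Module.finrank ℝ ↥S = 5 := by
  refine ⟨LinearMap.range law, ?_, ?_⟩
  · intro A
    constructor
    · rintro ⟨c, rfl⟩
      exact ⟨law_equi c, law_selfAdj c⟩
    · rintro ⟨hE, hS⟩
      exact exists_law hE hS
  · have h := LinearMap.finrank_range_of_inj law_injective
    rw [Module.finrank_fin_fun] at h
    exact h
end
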